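/- arXiv:math/0612274 — 2 statements merged into one kernel-verified Lean document; each statement's English description precedes it below -/
import Mathlib

section
/- (Pointwise model smoothing estimates in low dimensions.) Let m > 0. (i) In dimension n = 1 there is a constant C > 0 such that for every x ∈ ℝ and every Schwartz φ on ℝ: ‖|D_x|^{(m-1)/2} e^{it|D_x|^m} φ(x)‖_{L²(ℝ_t)} ≤ C‖φ‖_{L²(ℝ)}. (ii) In dimension n = 2 there is a constant C > 0 such that for every x ∈ ℝ and every Schwartz φ on ℝ²: ‖|D_y|^{(m-1)/2} e^{itD_x|D_y|^{m-1}} φ(x,·)‖_{L²(ℝ_t×ℝ_y)} ≤ C‖φ‖_{L²(ℝ²)}. In particular both estimates follow from the identity ‖e^{itD_x}φ(x)‖_{L²(ℝ_t)} = ‖φ‖_{L²(ℝ)} (conservation of energy for the travelling wave e^{itD_x}φ(x) = φ(x+t)). -/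
open MeasureTheory
open scoped ENNReal

noncomputable section

/-- The Fourier transform on `ℝ`. -/
def ft1 (φ : ℝ → ℂ) (ξ : ℝ) : ℂ :=
  ∫ x : ℝ, Complex.exp (-(Complex.I * ((x * ξ : ℝ) : ℂ))) * φ x

/-- `σ(D_x) e^{i t a(D_x)} φ (x)` on `ℝ`. -/
def evo1 (a : ℝ → ℝ) (σ : ℝ → ℂ) (φ : ℝ → ℂ) (t x : ℝ) : ℂ :=
  (2 * Real.pi : ℝ)⁻¹ •
    ∫ ξ : ℝ, Complex.exp (Complex.I * ((x * ξ + t * a ξ : ℝ) : ℂ)) * σ ξ * ft1 φ ξ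

/-- The Fourier transform on `ℝ²` (variables `(x,y)`, dual `(ξ,η)`). -/
def ft2 (φ : ℝ × ℝ → ℂ) (ξ : ℝ × ℝ) : ℂ :=
  ∫ x : ℝ × ℝ, Complex.exp (-(Complex.I * ((x.1 * ξ.1 + x.2 * ξ.2 : ℝ) : ℂ))) * φ x

/-- `σ(D_x,D_y) e^{i t a(D_x,D_y)} φ (x,y)` on `ℝ²`. -/
def evo2 (a : ℝ × ℝ → ℝ) (σ : ℝ × ℝ → ℂ) (φ : ℝ × ℝ → ℂ) (t : ℝ) (x : ℝ × ℝ) : ℂ :=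
  ((2 * Real.pi) ^ 2 : ℝ)⁻¹ •
    ∫ ξ : ℝ × ℝ,
      Complex.exp (Complex.I * ((x.1 * ξ.1 + x.2 * ξ.2 + t * a ξ : ℝ) : ℂ)) * σ ξ * ft2 φ ξ

open FourierTransform

theorem continuous_fourier_of_integrable {V : Type*} [NormedAddCommGroup V]
    [InnerProductSpace ℝ V] [FiniteDimensional ℝ V] [MeasurableSpace V] [BorelSpace V] {f : V → ℂ}
    (hf : Integrable f) : Continuous (𝓕 f) :=
  VectorFourier.fourierIntegral_continuous Real.continuous_fourierChar continuous_inner hf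

theorem eLpNorm_fourier_eq {V : Type*} [NormedAddCommGroup V] [InnerProductSpace ℝ V]
    [FiniteDimensional ℝ V] [MeasurableSpace V] [BorelSpace V] {f : V → ℂ}
    (h1 : Integrable f) (h2 : MemLp f 2) :
    eLpNorm (𝓕 f) 2 volume = eLpNorm f 2 volume := by
  set F := h2.toLp f
  have hcont : Continuous (𝓕 f) := continuous_fourier_of_integrable h1
  have key : ∀ g : SchwartzMap V ℂ,
      ∫ x, g x • (𝓕 F : Lp (α := V) ℂ 2 volume) x = ∫ x, g x • 𝓕 f x := by
    intro g
    have e1 := congrArg (fun T => T g) (Lp.fourier_toTemperedDistribution_eq F)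
    simp only [TemperedDistribution.fourier_apply, Lp.toTemperedDistribution_apply] at e1
    rw [← e1]
    have e2 := VectorFourier.integral_fourierIntegral_smul_eq_flip (L := innerₗ V)
      (μ := volume) (ν := volume) Real.continuous_fourierChar
      continuous_inner g.integrable h1
    rw [flip_innerₗ] at e2
    refine Eq.trans ?_ e2
    apply integral_congr_ae
    filter_upwards [h2.coeFn_toLp] with x hx
    rw [hx]
    rfl
  have hae : (𝓕 F : Lp (α := V) ℂ 2 volume) =ᵐ[volume] 𝓕 f := by
    refine ae_eq_of_integral_contDiff_smul_eq ((Lp.memLp _).locallyIntegrable (by norm_num))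
      hcont.locallyIntegrable fun g hg hc => ?_
    have hg₁ : HasCompactSupport (Complex.ofRealCLM ∘ g) := hc.comp_left rfl
    have hg₂ : ContDiff ℝ (↑(⊤ : ℕ∞)) (Complex.ofRealCLM ∘ g) := by fun_prop
    simpa using key (hg₁.toSchwartzMap hg₂)
  rw [← eLpNorm_congr_ae hae, ← eLpNorm_congr_ae h2.coeFn_toLp]
  have := Lp.norm_fourier_eq F
  rw [Lp.norm_def, Lp.norm_def, ENNReal.toReal_eq_toReal_iff' (Lp.eLpNorm_ne_top _)
    (Lp.eLpNorm_ne_top _)] at this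
  exact this

theorem sq_eLpNorm_two {α : Type*} [MeasurableSpace α] (μ : Measure α) (f : α → ℂ) :
    eLpNorm f 2 μ ^ 2 = ∫⁻ x, ‖f x‖ₑ ^ 2 ∂μ := by
  simpa using eLpNorm_nnreal_pow_eq_lintegral (f := f) (μ := μ) (p := 2) two_ne_zero

theorem memLp_two_of_lintegral_sq {α : Type*} [MeasurableSpace α] {μ : Measure α} {f : α → ℂ}
    (hf : AEStronglyMeasurable f μ) (h : ∫⁻ x, ‖f x‖ₑ ^ 2 ∂μ < ∞) : MemLp f 2 μ := by
  refine ⟨hf, ?_⟩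
  rw [← sq_eLpNorm_two] at h
  simpa using h

/-- The Fourier integral with the angular-frequency normalization, as a rescaled `𝓕`. -/
theorem integral_exp_inner_eq_fourier {V : Type*} [NormedAddCommGroup V]
    [InnerProductSpace ℝ V] [FiniteDimensional ℝ V] [MeasurableSpace V] [BorelSpace V]
    (g : V → ℂ) (w : V) :
    ∫ v, Complex.exp (Complex.I * (inner ℝ v w : ℝ)) * g v = 𝓕 g ((-(2 * Real.pi)⁻¹ : ℝ) • w) := by
  rw [Real.fourier_eq']
  refine integral_congr_ae (.of_forall fun v => ?_)
  have : (Real.pi : ℂ) ≠ 0 := by exact_mod_cast Real.pi_ne_zero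
  simp only [inner_smul_right, smul_eq_mul]
  congr 2
  push_cast
  field_simp

theorem continuous_integral_exp_inner {V : Type*} [NormedAddCommGroup V]
    [InnerProductSpace ℝ V] [FiniteDimensional ℝ V] [MeasurableSpace V] [BorelSpace V]
    {g : V → ℂ} (h1 : Integrable g) :
    Continuous fun w => ∫ v, Complex.exp (Complex.I * (inner ℝ v w : ℝ)) * g v := by
  simp_rw [integral_exp_inner_eq_fourier]
  exact (continuous_fourier_of_integrable h1).comp (continuous_const_smul _)

theorem lintegral_sq_integral_exp_inner {V : Type*} [NormedAddCommGroup V]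
    [InnerProductSpace ℝ V] [FiniteDimensional ℝ V] [MeasurableSpace V] [BorelSpace V]
    {g : V → ℂ} (h1 : Integrable g) (h2 : ∫⁻ v, ‖g v‖ₑ ^ 2 < ∞) :
    ∫⁻ w, ‖∫ v, Complex.exp (Complex.I * (inner ℝ v w : ℝ)) * g v‖ₑ ^ 2
      = ENNReal.ofReal ((2 * Real.pi) ^ Module.finrank ℝ V) * ∫⁻ v, ‖g v‖ₑ ^ 2 := by
  have hr : (-(2 * Real.pi)⁻¹ : ℝ) ≠ 0 := by have := Real.pi_pos; simp [this.ne']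
  simp_rw [integral_exp_inner_eq_fourier]
  have hm : Measurable fun w => ‖𝓕 g w‖ₑ ^ 2 :=
    ((continuous_fourier_of_integrable h1).measurable.enorm.pow_const 2)
  have h3 := lintegral_map (μ := (volume : Measure V)) hm
    (measurable_const_smul (-(2 * Real.pi)⁻¹ : ℝ))
  have h4 := Measure.map_addHaar_smul (volume : Measure V) hr
  rw [← h3]
  erw [h4]
  rw [lintegral_smul_measure, ← sq_eLpNorm_two,
    eLpNorm_fourier_eq h1 (memLp_two_of_lintegral_sq h1.1 h2), sq_eLpNorm_two]
  have := Real.pi_pos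
  rw [smul_eq_mul]
  congr 2
  rw [abs_inv, abs_pow, abs_neg, abs_of_pos (by positivity), inv_pow, inv_inv]

theorem continuous_integral_exp_real {g : ℝ → ℂ} (h1 : Integrable g) :
    Continuous fun w : ℝ => ∫ v : ℝ, Complex.exp (Complex.I * (w * v : ℝ)) * g v :=
  continuous_integral_exp_inner h1

theorem lintegral_sq_integral_exp_real {g : ℝ → ℂ} (h1 : Integrable g)
    (h2 : ∫⁻ v, ‖g v‖ₑ ^ 2 < ∞) :
    ∫⁻ w : ℝ, ‖∫ v : ℝ, Complex.exp (Complex.I * (w * v : ℝ)) * g v‖ₑ ^ 2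
      = ENNReal.ofReal (2 * Real.pi) * ∫⁻ v, ‖g v‖ₑ ^ 2 := by
  have := lintegral_sq_integral_exp_inner h1 h2
  rw [Module.finrank_self, pow_one] at this
  exact this

theorem integral_exp_prod_eq_inner (g : ℝ × ℝ → ℂ) (w : WithLp 2 (ℝ × ℝ)) :
    ∫ v : ℝ × ℝ, Complex.exp (Complex.I * (w.fst * v.1 + w.snd * v.2 : ℝ)) * g v
      = ∫ v : WithLp 2 (ℝ × ℝ),
          Complex.exp (Complex.I * (inner ℝ v w : ℝ)) * g (WithLp.ofLp v) := by
  rw [← (WithLp.volume_preserving_symm_measurableEquiv_toLp_prod ℝ ℝ).integral_comp']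
  rfl

theorem integrable_comp_ofLp_prod {g : ℝ × ℝ → ℂ} (h1 : Integrable g) :
    Integrable fun v : WithLp 2 (ℝ × ℝ) => g (WithLp.ofLp v) :=
  (WithLp.volume_preserving_ofLp ℝ ℝ).integrable_comp_of_integrable h1

theorem continuous_integral_exp_prod {g : ℝ × ℝ → ℂ} (h1 : Integrable g) :
    Continuous fun w : ℝ × ℝ =>
      ∫ v : ℝ × ℝ, Complex.exp (Complex.I * (w.1 * v.1 + w.2 * v.2 : ℝ)) * g v := by
  have := (continuous_integral_exp_inner (integrable_comp_ofLp_prod h1)).comp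
    (WithLp.prod_continuous_toLp 2 ℝ ℝ)
  simp only [Function.comp_def, ← integral_exp_prod_eq_inner] at this
  exact this

theorem lintegral_sq_integral_exp_prod {g : ℝ × ℝ → ℂ} (h1 : Integrable g)
    (h2 : ∫⁻ v, ‖g v‖ₑ ^ 2 < ∞) :
    ∫⁻ w : ℝ × ℝ, ‖∫ v : ℝ × ℝ, Complex.exp (Complex.I * (w.1 * v.1 + w.2 * v.2 : ℝ)) * g v‖ₑ ^ 2
      = ENNReal.ofReal ((2 * Real.pi) ^ 2) * ∫⁻ v, ‖g v‖ₑ ^ 2 := by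
  have hp := WithLp.volume_preserving_symm_measurableEquiv_toLp_prod ℝ ℝ
  have e1 := hp.lintegral_comp_emb (MeasurableEquiv.measurableEmbedding _)
    (fun v => ‖g v‖ₑ ^ 2)
  have e2 := hp.lintegral_comp_emb (MeasurableEquiv.measurableEmbedding _)
    (fun w => ‖∫ v : ℝ × ℝ,
      Complex.exp (Complex.I * (w.1 * v.1 + w.2 * v.2 : ℝ)) * g v‖ₑ ^ 2)
  rw [← e1] at h2 ⊢
  rw [← e2]
  have h3 := lintegral_sq_integral_exp_inner (integrable_comp_ofLp_prod h1) h2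
  have hd : Module.finrank ℝ (WithLp 2 (ℝ × ℝ)) = 2 := by
    rw [(WithLp.linearEquiv 2 ℝ (ℝ × ℝ)).finrank_eq]; simp
  rw [hd] at h3
  simp_rw [← integral_exp_prod_eq_inner] at h3
  exact h3

/-- If `Ψ` linearizes the phase `A` into `B`, pushes the weighted measure `w μ` to `ν`, and
`w · σ(Ψ)² = c`, then an `L²` bound for the oscillatory integral with phase `B` transfers to the
one with phase `A` and amplitude `σ`. -/
theorem lintegral_sq_oscillatory_le {α β τ : Type*} [MeasurableSpace α] [MeasurableSpace β]
    [MeasurableSpace τ] {μ : Measure α} {ν : Measure β} {ρ : Measure τ} {B : τ → α → ℝ}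
    {c₀ : ℝ≥0∞}
    (hP : ∀ g : α → ℂ, Integrable g μ → ∫⁻ v, ‖g v‖ₑ ^ 2 ∂μ < ∞ →
      ∫⁻ s, ‖∫ v, Complex.exp (Complex.I * (B s v : ℝ)) * g v ∂μ‖ₑ ^ 2 ∂ρ
        ≤ c₀ * ∫⁻ v, ‖g v‖ₑ ^ 2 ∂μ)
    {Ψ : α → β} (hΨ : Measurable Ψ) {w : α → NNReal} (hw : Measurable w)
    (hmap : (μ.withDensity fun v => (w v : ℝ≥0∞)).map Ψ = ν)
    {A : τ → β → ℝ} (hAm : ∀ s, Measurable (A s)) (hA : ∀ s, ∀ᵐ v ∂μ, A s (Ψ v) = B s v)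
    {σ : β → ℝ} (hσ : Measurable σ) {c : ℝ≥0∞} (hctop : c ≠ ∞)
    (hc : ∀ᵐ v ∂μ, (w v : ℝ≥0∞) * ‖σ (Ψ v)‖ₑ ^ 2 = c)
    {k : β → ℂ} (hk : Measurable k) (hk2 : ∫⁻ ξ, ‖k ξ‖ₑ ^ 2 ∂ν < ∞) :
    ∫⁻ s, ‖∫ ξ, Complex.exp (Complex.I * (A s ξ : ℝ)) * ((σ ξ : ℂ) * k ξ) ∂ν‖ₑ ^ 2 ∂ρ
      ≤ c₀ * (c * ∫⁻ ξ, ‖k ξ‖ₑ ^ 2 ∂ν) := by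
  have hσc : Measurable fun ξ => (σ ξ : ℂ) := Complex.measurable_ofReal.comp hσ
  have hσk : Measurable fun ξ => (σ ξ : ℂ) * k ξ := hσc.mul hk
  have hkΨ : Measurable fun v => ‖k (Ψ v)‖ₑ ^ 2 := (hk.comp hΨ).enorm.pow_const 2
  have hem : ∀ s, Measurable fun ξ => Complex.exp (Complex.I * (A s ξ : ℝ)) := fun s => by
    have := hAm s
    fun_prop
  by_cases hint : Integrable (fun ξ => (σ ξ : ℂ) * k ξ) ν
  · set G : α → ℂ := fun v => w v • ((σ (Ψ v) : ℂ) * k (Ψ v)) with hG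
    have hGint : Integrable G μ := by
      rw [← hmap] at hint
      have h := (integrable_map_measure hint.1 hΨ.aemeasurable).1 hint
      exact (integrable_withDensity_iff_integrable_smul hw).1 h
    have hGsq : ∫⁻ v, ‖G v‖ₑ ^ 2 ∂μ = c * ∫⁻ ξ, ‖k ξ‖ₑ ^ 2 ∂ν := by
      rw [← hmap, lintegral_map (hk.enorm.pow_const 2) hΨ,
        lintegral_withDensity_eq_lintegral_mul _ hw.coe_nnreal_ennreal hkΨ,
        ← lintegral_const_mul' _ _ hctop]
      refine lintegral_congr_ae ?_
      filter_upwards [hc] with v hv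
      simp only [hG, Pi.mul_apply, ← hv, NNReal.smul_def, Complex.real_smul, enorm_mul, mul_pow]
      have e1 : ‖((σ (Ψ v) : ℝ) : ℂ)‖ₑ = ‖σ (Ψ v)‖ₑ := by
        simp [enorm_eq_nnnorm]
      have e2 : ‖(((w v : NNReal) : ℝ) : ℂ)‖ₑ = (w v : ℝ≥0∞) := by
        simp [enorm_eq_nnnorm]
      rw [e1, e2]
      ring
    rw [← hGsq]
    refine le_of_eq_of_le (lintegral_congr fun s => ?_)
      (hP G hGint (hGsq ▸ ENNReal.mul_lt_top hctop.lt_top hk2))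
    congr 2
    have hmeas : Measurable fun ξ =>
        Complex.exp (Complex.I * (A s ξ : ℝ)) * ((σ ξ : ℂ) * k ξ) := (hem s).mul hσk
    rw [← hmap, integral_map hΨ.aemeasurable hmeas.aestronglyMeasurable,
      integral_withDensity_eq_integral_smul hw]
    refine integral_congr_ae ?_
    filter_upwards [hA s] with v hv
    rw [hv, hG, mul_smul_comm]
  · have h0 : ∀ s, ∫ ξ, Complex.exp (Complex.I * (A s ξ : ℝ)) * ((σ ξ : ℂ) * k ξ) ∂ν = 0 := by
      intro s
      refine integral_undef fun h => hint ?_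
      rw [← integrable_norm_iff hσk.aestronglyMeasurable]
      refine h.norm.congr (.of_forall fun ξ => ?_)
      simp only [norm_mul, mul_comm Complex.I, Complex.norm_exp_ofReal_mul_I, one_mul]
    simp [h0]

theorem map_rpow_withDensity_restrict_Ioi {p : ℝ} (hp : 0 < p) :
    ((volume.restrict (Set.Ioi (0 : ℝ))).withDensity
        fun η => ((p * η ^ (p - 1)).toNNReal : ℝ≥0∞)).map (fun η => η ^ p)
      = volume.restrict (Set.Ioi 0) := by
  have hm : Measurable fun η : ℝ => η ^ p := by fun_prop
  ext s hs
  set S := Set.Ioi (0 : ℝ) ∩ (fun η => η ^ p) ⁻¹' s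
  have hS : MeasurableSet S := measurableSet_Ioi.inter (hm hs)
  have himg : (fun η : ℝ => η ^ p) '' S = s ∩ Set.Ioi 0 := by
    ext y
    constructor
    · rintro ⟨x, ⟨hx, hxs⟩, rfl⟩
      exact ⟨hxs, Real.rpow_pos_of_pos hx p⟩
    · rintro ⟨hy, hy0⟩
      have e : (y ^ p⁻¹) ^ p = y := Real.rpow_inv_rpow (le_of_lt hy0) hp.ne'
      refine ⟨y ^ p⁻¹, ⟨Real.rpow_pos_of_pos hy0 _, ?_⟩, e⟩
      simpa [e] using hy
  have hinj : Set.InjOn (fun η : ℝ => η ^ p) S := fun x hx y hy h =>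
    (Real.rpow_left_inj (le_of_lt hx.1) (le_of_lt hy.1) hp.ne').1 h
  have key := lintegral_image_eq_lintegral_abs_deriv_mul hS
    (fun x hx => (Real.hasDerivAt_rpow_const (p := p) (Or.inl (ne_of_gt hx.1))).hasDerivWithinAt)
    hinj (fun _ => 1)
  rw [himg] at key
  rw [Measure.map_apply hm hs, withDensity_apply _ (hm hs), Measure.restrict_restrict (hm hs),
    Measure.restrict_apply hs, Set.inter_comm]
  simp only [lintegral_const, one_mul, mul_one, Measure.restrict_apply_univ] at key
  rw [key]
  refine setLIntegral_congr_fun hS fun x hx => ?_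
  have : 0 ≤ p * x ^ (p - 1) := mul_nonneg hp.le (Real.rpow_nonneg (le_of_lt hx.1) _)
  simp only [abs_of_nonneg this]
  rfl

theorem map_mul_abs_rpow_withDensity (q : ℝ) :
    ((volume : Measure (ℝ × ℝ)).withDensity
        fun v => ((|v.2| ^ q).toNNReal : ℝ≥0∞)).map (fun v => (v.1 * |v.2| ^ q, v.2))
      = volume := by
  have hm : Measurable fun v : ℝ × ℝ => (v.1 * |v.2| ^ q, v.2) := by fun_prop
  have hw : Measurable fun v : ℝ × ℝ => ((|v.2| ^ q).toNNReal : ℝ≥0∞) := by fun_prop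
  ext s hs
  have hind : Measurable (s.indicator (1 : ℝ × ℝ → ℝ≥0∞)) := measurable_one.indicator hs
  have hind' : Measurable fun v : ℝ × ℝ =>
      s.indicator (1 : ℝ × ℝ → ℝ≥0∞) (v.1 * |v.2| ^ q, v.2) := hind.comp hm
  rw [← lintegral_indicator_one hs, ← lintegral_indicator_one hs, lintegral_map hind hm,
    lintegral_withDensity_eq_lintegral_mul _ hw hind', Measure.volume_eq_prod,
    lintegral_prod_symm _ (hw.mul hind').aemeasurable,
    lintegral_prod_symm _ hind.aemeasurable]
  refine lintegral_congr_ae ?_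
  filter_upwards [Measure.ae_ne volume (0 : ℝ)] with η hη
  have ha : 0 < |η| ^ q := Real.rpow_pos_of_pos (abs_pos.2 hη) q
  have hs1 : Measurable fun ξ : ℝ => s.indicator (1 : ℝ × ℝ → ℝ≥0∞) (ξ, η) :=
    hind.comp (by fun_prop)
  conv_rhs => rw [← Real.smul_map_volume_mul_right ha.ne']
  rw [lintegral_smul_measure, lintegral_map hs1 (by fun_prop), abs_of_pos ha]
  simp only [Pi.mul_apply]
  rw [lintegral_const_mul' _ _ ENNReal.coe_ne_top]
  rfl

theorem ft1_eq_integral_exp (φ : ℝ → ℂ) (ξ : ℝ) :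
    ft1 φ ξ = ∫ x : ℝ, Complex.exp (Complex.I * ((-ξ) * x : ℝ)) * φ x := by
  unfold ft1
  refine integral_congr_ae (.of_forall fun x => ?_)
  simp only
  congr 2
  push_cast
  ring

theorem ft2_eq_integral_exp (φ : ℝ × ℝ → ℂ) (ξ : ℝ × ℝ) :
    ft2 φ ξ
      = ∫ x : ℝ × ℝ, Complex.exp (Complex.I * ((-ξ).1 * x.1 + (-ξ).2 * x.2 : ℝ)) * φ x := by
  unfold ft2
  refine integral_congr_ae (.of_forall fun x => ?_)
  simp only [Prod.fst_neg, Prod.snd_neg]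
  congr 2
  push_cast
  ring

theorem SchwartzMap.lintegral_sq_lt_top {E : Type*} [NormedAddCommGroup E] [NormedSpace ℝ E]
    [MeasurableSpace E] [BorelSpace E] [SecondCountableTopology E] {μ : Measure E}
    [μ.HasTemperateGrowth] (φ : SchwartzMap E ℂ) : ∫⁻ x, ‖φ x‖ₑ ^ 2 ∂μ < ∞ := by
  rw [← sq_eLpNorm_two]
  exact ENNReal.pow_lt_top (φ.memLp 2 μ).2

theorem continuous_ft1 (φ : SchwartzMap ℝ ℂ) : Continuous (ft1 φ) := by
  simp_rw [funext (ft1_eq_integral_exp φ)]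
  exact (continuous_integral_exp_real φ.integrable).comp continuous_neg

theorem continuous_ft2 (φ : SchwartzMap (ℝ × ℝ) ℂ) : Continuous (ft2 φ) := by
  simp_rw [funext (ft2_eq_integral_exp φ)]
  exact (continuous_integral_exp_prod φ.integrable).comp continuous_neg

theorem lintegral_sq_ft1 (φ : SchwartzMap ℝ ℂ) :
    ∫⁻ ξ, ‖ft1 φ ξ‖ₑ ^ 2 = ENNReal.ofReal (2 * Real.pi) * ∫⁻ x, ‖φ x‖ₑ ^ 2 := by
  rw [← lintegral_sq_integral_exp_real φ.integrable φ.lintegral_sq_lt_top]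
  simp_rw [ft1_eq_integral_exp]
  exact (Measure.measurePreserving_neg (volume : Measure ℝ)).lintegral_comp_emb
    (MeasurableEquiv.neg ℝ).measurableEmbedding
    (fun w : ℝ => ‖∫ v : ℝ, Complex.exp (Complex.I * (w * v : ℝ)) * φ v‖ₑ ^ 2)

theorem lintegral_sq_ft2 (φ : SchwartzMap (ℝ × ℝ) ℂ) :
    ∫⁻ ξ, ‖ft2 φ ξ‖ₑ ^ 2 = ENNReal.ofReal ((2 * Real.pi) ^ 2) * ∫⁻ x, ‖φ x‖ₑ ^ 2 := by
  rw [← lintegral_sq_integral_exp_prod φ.integrable φ.lintegral_sq_lt_top]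
  simp_rw [ft2_eq_integral_exp]
  exact (Measure.measurePreserving_neg (volume : Measure (ℝ × ℝ))).lintegral_comp_emb
    (MeasurableEquiv.neg (ℝ × ℝ)).measurableEmbedding
    (fun w : ℝ × ℝ => ‖∫ v : ℝ × ℝ,
      Complex.exp (Complex.I * (w.1 * v.1 + w.2 * v.2 : ℝ)) * φ v‖ₑ ^ 2)

theorem integrable_ft1 (φ : SchwartzMap ℝ ℂ) : Integrable (ft1 φ) := by
  have hr : ((2 * Real.pi)⁻¹ : ℝ) ≠ 0 := by have := Real.pi_pos; simp [this.ne']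
  have h : Integrable fun ξ : ℝ => (𝓕 φ : SchwartzMap ℝ ℂ) ((2 * Real.pi)⁻¹ • ξ) :=
    (𝓕 φ : SchwartzMap ℝ ℂ).integrable.comp_smul hr
  refine h.congr (.of_forall fun ξ => ?_)
  have e := integral_exp_inner_eq_fourier (V := ℝ) φ (-ξ)
  rw [smul_neg, neg_smul, neg_neg] at e
  simp only [SchwartzMap.fourier_coe]
  rw [← e, ft1_eq_integral_exp]
  rfl

theorem eLpNorm_two_le_of_lintegral_sq_le {α β : Type*} [MeasurableSpace α] [MeasurableSpace β]
    {μ : Measure α} {ν : Measure β} {f : α → ℂ} {g : β → ℂ} {C : ℝ≥0∞}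
    (h : ∫⁻ x, ‖f x‖ₑ ^ 2 ∂μ ≤ C ^ 2 * ∫⁻ x, ‖g x‖ₑ ^ 2 ∂ν) :
    eLpNorm f 2 μ ≤ C * eLpNorm g 2 ν := by
  rw [← ENNReal.pow_le_pow_left_iff two_ne_zero, mul_pow, sq_eLpNorm_two, sq_eLpNorm_two]
  exact h

theorem eLpNorm_two_eq_of_lintegral_sq_eq {α β : Type*} [MeasurableSpace α] [MeasurableSpace β]
    {μ : Measure α} {ν : Measure β} {f : α → ℂ} {g : β → ℂ}
    (h : ∫⁻ x, ‖f x‖ₑ ^ 2 ∂μ = ∫⁻ x, ‖g x‖ₑ ^ 2 ∂ν) :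
    eLpNorm f 2 μ = eLpNorm g 2 ν := by
  apply le_antisymm
  · simpa using eLpNorm_two_le_of_lintegral_sq_le (C := 1) (by simpa using h.le)
  · simpa using eLpNorm_two_le_of_lintegral_sq_le (C := 1) (by simpa using h.ge)

/-- The half-line form of the one-dimensional smoothing estimate. -/
theorem lintegral_sq_integral_Ioi_rpow_le {m : ℝ} (hm : 0 < m) {k : ℝ → ℂ} (hk : Measurable k)
    (hk2 : ∫⁻ ξ in Set.Ioi 0, ‖k ξ‖ₑ ^ 2 < ∞) :
    ∫⁻ t : ℝ, ‖∫ ξ in Set.Ioi (0 : ℝ), Complex.exp (Complex.I * (t * |ξ| ^ m : ℝ)) *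
        (((|ξ| ^ ((m - 1) / 2) : ℝ) : ℂ) * k ξ)‖ₑ ^ 2
      ≤ ENNReal.ofReal (2 * Real.pi) *
          (ENNReal.ofReal m⁻¹ * ∫⁻ ξ in Set.Ioi 0, ‖k ξ‖ₑ ^ 2) := by
  refine lintegral_sq_oscillatory_le (B := fun t η => t * η) (c₀ := ENNReal.ofReal (2 * Real.pi))
    (μ := volume.restrict (Set.Ioi 0)) (A := fun t ξ => t * |ξ| ^ m) ?_
    (by fun_prop : Measurable fun η : ℝ => η ^ m⁻¹)
    (by fun_prop : Measurable fun η : ℝ => (m⁻¹ * η ^ (m⁻¹ - 1)).toNNReal)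
    (map_rpow_withDensity_restrict_Ioi (inv_pos.2 hm)) (fun s => by fun_prop) ?_
    (by fun_prop) ENNReal.ofReal_ne_top ?_ hk hk2
  · intro g hg hg2
    replace hg := (integrable_indicator_iff measurableSet_Ioi).2 hg
    have e : ∫⁻ v, ‖(Set.Ioi (0 : ℝ)).indicator g v‖ₑ ^ 2
        = ∫⁻ v in Set.Ioi (0 : ℝ), ‖g v‖ₑ ^ 2 := by
      rw [← lintegral_indicator measurableSet_Ioi]
      refine lintegral_congr fun v => ?_
      by_cases hv : v ∈ Set.Ioi (0 : ℝ) <;> simp [hv]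
    rw [← e] at hg2 ⊢
    rw [← lintegral_sq_integral_exp_real hg hg2]
    refine (lintegral_congr fun t => ?_).le
    rw [← integral_indicator measurableSet_Ioi]
    congr 2
    refine integral_congr_ae (.of_forall fun v => ?_)
    by_cases hv : v ∈ Set.Ioi (0 : ℝ) <;> simp [hv]
  · intro t
    filter_upwards [ae_restrict_mem measurableSet_Ioi] with η hη
    have hη : 0 < η := hη
    rw [abs_of_pos (Real.rpow_pos_of_pos hη _), Real.rpow_inv_rpow hη.le hm.ne']
  · filter_upwards [ae_restrict_mem measurableSet_Ioi] with η hη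
    have hη : 0 < η := hη
    rw [abs_of_pos (Real.rpow_pos_of_pos hη _), ← Real.rpow_mul hη.le,
      Real.enorm_of_nonneg (Real.rpow_nonneg hη.le _),
      ← ENNReal.ofReal_pow (Real.rpow_nonneg hη.le _)]
    change ENNReal.ofReal _ * _ = _
    rw [← ENNReal.ofReal_mul (by positivity), ← Real.rpow_natCast, ← Real.rpow_mul hη.le,
      mul_assoc, ← Real.rpow_add hη]
    have : m⁻¹ - 1 + m⁻¹ * ((m - 1) / 2) * ((2 : ℕ) : ℝ) = 0 := by
      push_cast
      field_simp
      ring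
    rw [this, Real.rpow_zero, mul_one]

theorem lintegral_sq_integral_mul_abs_rpow_le (p : ℝ) {k : ℝ × ℝ → ℂ} (hk : Measurable k)
    (hk2 : ∫⁻ ξ, ‖k ξ‖ₑ ^ 2 < ∞) :
    ∫⁻ s : ℝ × ℝ, ‖∫ ξ : ℝ × ℝ,
        Complex.exp (Complex.I * (s.1 * (ξ.1 * |ξ.2| ^ p) + s.2 * ξ.2 : ℝ)) *
        (((|ξ.2| ^ (p / 2) : ℝ) : ℂ) * k ξ)‖ₑ ^ 2
      ≤ ENNReal.ofReal ((2 * Real.pi) ^ 2) * (1 * ∫⁻ ξ, ‖k ξ‖ₑ ^ 2) := by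
  have hne : ∀ᵐ v : ℝ × ℝ, v.2 ≠ 0 :=
    Measure.quasiMeasurePreserving_snd.ae (Measure.ae_ne volume (0 : ℝ))
  have hmΨ : Measurable fun v : ℝ × ℝ => (v.1 * |v.2| ^ (-p), v.2) := by fun_prop
  have hmw : Measurable fun v : ℝ × ℝ => (|v.2| ^ (-p)).toNNReal := by fun_prop
  have hA : ∀ s : ℝ × ℝ, ∀ᵐ v : ℝ × ℝ,
      s.1 * (v.1 * |v.2| ^ (-p) * |v.2| ^ p) + s.2 * v.2 = s.1 * v.1 + s.2 * v.2 := by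
    intro s
    filter_upwards [hne] with v hv
    rw [mul_assoc v.1, ← Real.rpow_add (abs_pos.2 hv), neg_add_cancel, Real.rpow_zero, mul_one]
  have hc : ∀ᵐ v : ℝ × ℝ, ((|v.2| ^ (-p)).toNNReal : ℝ≥0∞) * ‖|v.2| ^ (p / 2)‖ₑ ^ 2 = 1 := by
    filter_upwards [hne] with v hv
    have hv' := abs_pos.2 hv
    rw [Real.enorm_of_nonneg (Real.rpow_nonneg hv'.le _),
      ← ENNReal.ofReal_pow (Real.rpow_nonneg hv'.le _)]
    change ENNReal.ofReal _ * _ = _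
    rw [← ENNReal.ofReal_mul (by positivity), ← Real.rpow_natCast, ← Real.rpow_mul hv'.le,
      ← Real.rpow_add hv']
    simp
  have hmA : ∀ s : ℝ × ℝ, Measurable fun ξ : ℝ × ℝ => s.1 * (ξ.1 * |ξ.2| ^ p) + s.2 * ξ.2 :=
    fun s => by fun_prop
  have hmσ : Measurable fun ξ : ℝ × ℝ => |ξ.2| ^ (p / 2) := by fun_prop
  exact lintegral_sq_oscillatory_le (B := fun (s : ℝ × ℝ) (v : ℝ × ℝ) => s.1 * v.1 + s.2 * v.2)
    (fun g hg hg2 => (lintegral_sq_integral_exp_prod hg hg2).le)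
    hmΨ hmw (map_mul_abs_rpow_withDensity (-p)) hmA hA hmσ ENNReal.one_ne_top hc hk hk2

theorem enorm_exp_I_mul_ofReal_mul (a : ℝ) (z : ℂ) :
    ‖Complex.exp (Complex.I * (a : ℂ)) * z‖ₑ = ‖z‖ₑ := by
  rw [← ofReal_norm, norm_mul, mul_comm Complex.I, Complex.norm_exp_ofReal_mul_I, one_mul,
    ofReal_norm]

theorem integral_eq_integral_Ioi_add_integral_Ioi_neg {f : ℝ → ℂ} (hf : Integrable f) :
    ∫ x, f x = (∫ x in Set.Ioi 0, f x) + ∫ x in Set.Ioi 0, f (-x) := by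
  have h := integral_comp_neg_Ioi (0 : ℝ) f
  rw [neg_zero] at h
  rw [h, add_comm]
  exact (intervalIntegral.integral_Iic_add_Ioi hf.integrableOn hf.integrableOn).symm

theorem enorm_integral_sq_le_of_halves (f : ℝ → ℂ) :
    ‖∫ x, f x‖ₑ ^ 2
      ≤ 2 * (‖∫ x in Set.Ioi 0, f x‖ₑ ^ 2 + ‖∫ x in Set.Ioi 0, f (-x)‖ₑ ^ 2) := by
  by_cases hf : Integrable f
  · rw [integral_eq_integral_Ioi_add_integral_Ioi_neg hf]
    refine (pow_le_pow_left' (enorm_add_le _ _) 2).trans ?_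
    have key (a b : ℝ≥0∞) : (a + b) ^ 2 ≤ 2 * (a ^ 2 + b ^ 2) := by
      have h := ENNReal.rpow_add_le_mul_rpow_add_rpow a b (p := 2) one_le_two
      norm_num at h
      exact h
    exact key _ _
  · simp [integral_undef hf]

theorem lintegral_sq_integral_abs_rpow_le {m : ℝ} (hm : 0 < m) {k : ℝ → ℂ}
    (hk : Continuous k) (hk2 : ∫⁻ ξ, ‖k ξ‖ₑ ^ 2 < ∞) :
    ∫⁻ t : ℝ, ‖∫ ξ : ℝ, Complex.exp (Complex.I * (t * |ξ| ^ m : ℝ)) *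
        (((|ξ| ^ ((m - 1) / 2) : ℝ) : ℂ) * k ξ)‖ₑ ^ 2
      ≤ ENNReal.ofReal (4 * Real.pi * m⁻¹) * ∫⁻ ξ, ‖k ξ‖ₑ ^ 2 := by
  have hneg : ∫⁻ ξ, ‖k (-ξ)‖ₑ ^ 2 = ∫⁻ ξ, ‖k ξ‖ₑ ^ 2 :=
    (Measure.measurePreserving_neg (volume : Measure ℝ)).lintegral_comp_emb
      (MeasurableEquiv.neg ℝ).measurableEmbedding (fun ξ => ‖k ξ‖ₑ ^ 2)
  have hsplit : (∫⁻ ξ in Set.Ioi 0, ‖k ξ‖ₑ ^ 2) + ∫⁻ ξ in Set.Ioi 0, ‖k (-ξ)‖ₑ ^ 2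
      = ∫⁻ ξ, ‖k ξ‖ₑ ^ 2 := by
    have h := (Measure.measurePreserving_neg (volume : Measure ℝ)).setLIntegral_comp_preimage_emb
      (MeasurableEquiv.neg ℝ).measurableEmbedding (fun ξ => ‖k ξ‖ₑ ^ 2) (Set.Iio 0)
    have e : (fun x : ℝ => -x) ⁻¹' Set.Iio 0 = Set.Ioi 0 := by ext; simp
    have h' : ∫⁻ ξ in Set.Ioi 0, ‖k (-ξ)‖ₑ ^ 2 = ∫⁻ ξ in Set.Iio 0, ‖k ξ‖ₑ ^ 2 := by
      rw [← h, ← e]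
    rw [h', setLIntegral_congr Iio_ae_eq_Iic, ← Set.compl_Ioi]
    exact lintegral_add_compl _ measurableSet_Ioi
  have hp := lintegral_sq_integral_Ioi_rpow_le hm hk.measurable
    ((setLIntegral_le_lintegral _ _).trans_lt hk2)
  have hn := lintegral_sq_integral_Ioi_rpow_le hm (hk.comp continuous_neg).measurable
    ((setLIntegral_le_lintegral _ _).trans_lt (hneg.trans_lt hk2))
  have hmeas : Measurable fun t : ℝ => ‖∫ ξ in Set.Ioi (0 : ℝ),
      Complex.exp (Complex.I * (t * |ξ| ^ m : ℝ)) *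
        (((|ξ| ^ ((m - 1) / 2) : ℝ) : ℂ) * k ξ)‖ₑ ^ 2 := by
    refine (StronglyMeasurable.measurable ?_).enorm.pow_const 2
    refine StronglyMeasurable.integral_prod_right (f := fun (t : ℝ) (ξ : ℝ) =>
      Complex.exp (Complex.I * (t * |ξ| ^ m : ℝ)) * (((|ξ| ^ ((m - 1) / 2) : ℝ) : ℂ) * k ξ)) ?_
    refine Measurable.stronglyMeasurable ?_
    have := hk.measurable
    unfold Function.uncurry
    fun_prop
  calc _ ≤ ∫⁻ t : ℝ, 2 * (‖∫ ξ in Set.Ioi (0 : ℝ),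
            Complex.exp (Complex.I * (t * |ξ| ^ m : ℝ)) *
              (((|ξ| ^ ((m - 1) / 2) : ℝ) : ℂ) * k ξ)‖ₑ ^ 2
          + ‖∫ ξ in Set.Ioi (0 : ℝ), Complex.exp (Complex.I * (t * |ξ| ^ m : ℝ)) *
              (((|ξ| ^ ((m - 1) / 2) : ℝ) : ℂ) * k (-ξ))‖ₑ ^ 2) :=
        lintegral_mono fun t => by
          refine (enorm_integral_sq_le_of_halves _).trans (le_of_eq ?_)
          simp only [abs_neg]
    _ ≤ 2 * (ENNReal.ofReal (2 * Real.pi) *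
          (ENNReal.ofReal m⁻¹ * ∫⁻ ξ in Set.Ioi 0, ‖k ξ‖ₑ ^ 2)
        + ENNReal.ofReal (2 * Real.pi) *
          (ENNReal.ofReal m⁻¹ * ∫⁻ ξ in Set.Ioi 0, ‖k (-ξ)‖ₑ ^ 2)) := by
        rw [lintegral_const_mul' _ _ ENNReal.ofNat_ne_top, lintegral_add_left hmeas]
        gcongr
        exact hn
    _ = _ := by
        have e : ENNReal.ofReal (4 * Real.pi * m⁻¹)
            = 2 * ENNReal.ofReal (2 * Real.pi) * ENNReal.ofReal m⁻¹ := by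
          rw [← ENNReal.ofReal_ofNat 2, ← ENNReal.ofReal_mul (by norm_num),
            ← ENNReal.ofReal_mul (by positivity)]
          congr 1
          ring
        rw [e, ← hsplit]
        ring

theorem lintegral_sq_smul {α : Type*} [MeasurableSpace α] (μ : Measure α) (r : ℝ) (f : α → ℂ) :
    ∫⁻ x, ‖r • f x‖ₑ ^ 2 ∂μ = ENNReal.ofReal (r ^ 2) * ∫⁻ x, ‖f x‖ₑ ^ 2 ∂μ := by
  rw [← lintegral_const_mul' _ _ ENNReal.ofReal_ne_top]
  refine lintegral_congr fun x => ?_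
  rw [enorm_smul, mul_pow, ← enorm_pow, Real.enorm_of_nonneg (sq_nonneg r)]

/-- Pointwise model smoothing estimates in low dimensions:
(i) `‖|D_x|^{(m-1)/2} e^{it|D_x|^m} φ(x)‖_{L²(ℝ_t)} ≤ C‖φ‖_{L²(ℝ)}` uniformly in `x ∈ ℝ`;
(ii) `‖|D_y|^{(m-1)/2} e^{itD_x|D_y|^{m-1}} φ(x,·)‖_{L²(ℝ_t×ℝ_y)} ≤ C‖φ‖_{L²(ℝ²)}`
uniformly in `x ∈ ℝ`; together with the exact energy identity
`‖e^{itD_x}φ(x)‖_{L²(ℝ_t)} = ‖φ‖_{L²(ℝ)}` from which both follow. -/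
theorem pointwise_model_estimates (m : ℝ) (hm : 0 < m) :
    (∃ C > 0, ∀ φ : SchwartzMap ℝ ℂ, ∀ x : ℝ,
      eLpNorm (fun t : ℝ =>
          evo1 (fun ξ => |ξ| ^ m) (fun ξ => ((|ξ| ^ ((m - 1) / 2) : ℝ) : ℂ)) (⇑φ) t x)
          2 volume
        ≤ ENNReal.ofReal C * eLpNorm (⇑φ) 2 volume) ∧
    (∃ C > 0, ∀ φ : SchwartzMap (ℝ × ℝ) ℂ, ∀ x : ℝ,
      eLpNorm (fun p : ℝ × ℝ =>
          evo2 (fun ξ => ξ.1 * |ξ.2| ^ (m - 1))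
            (fun ξ => ((|ξ.2| ^ ((m - 1) / 2) : ℝ) : ℂ)) (⇑φ) p.1 (x, p.2)) 2 volume
        ≤ ENNReal.ofReal C * eLpNorm (⇑φ) 2 volume) ∧
    (∀ φ : SchwartzMap ℝ ℂ, ∀ x : ℝ,
      eLpNorm (fun t : ℝ => evo1 (fun ξ => ξ) (fun _ => (1 : ℂ)) (⇑φ) t x) 2 volume
        = eLpNorm (⇑φ) 2 volume) := by
  have hπ := Real.pi_pos
  refine ⟨⟨√(2 * m⁻¹), by positivity, fun φ x => ?_⟩, ⟨1, one_pos, fun φ x => ?_⟩,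
    fun φ x => ?_⟩
  · refine eLpNorm_two_le_of_lintegral_sq_le ?_
    set k : ℝ → ℂ := fun ξ => Complex.exp (Complex.I * (x * ξ : ℝ)) * ft1 φ ξ
    have hk : Continuous k := by
      have := continuous_ft1 φ
      fun_prop
    have hk2 : ∫⁻ ξ, ‖k ξ‖ₑ ^ 2 = ENNReal.ofReal (2 * Real.pi) * ∫⁻ x, ‖φ x‖ₑ ^ 2 := by
      simp only [k, enorm_exp_I_mul_ofReal_mul, lintegral_sq_ft1]
    have h := lintegral_sq_integral_abs_rpow_le hm hk
      (hk2 ▸ ENNReal.mul_lt_top ENNReal.ofReal_lt_top φ.lintegral_sq_lt_top)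
    simp only [evo1, lintegral_sq_smul]
    have e : ∀ t ξ : ℝ, Complex.exp (Complex.I * ((x * ξ + t * |ξ| ^ m : ℝ) : ℂ)) *
        ((|ξ| ^ ((m - 1) / 2) : ℝ) : ℂ) * ft1 φ ξ
        = Complex.exp (Complex.I * (t * |ξ| ^ m : ℝ)) *
          (((|ξ| ^ ((m - 1) / 2) : ℝ) : ℂ) * k ξ) := fun t ξ => by
      rw [Complex.ofReal_add, mul_add, Complex.exp_add]
      ring
    simp only [e]
    refine (mul_le_mul_right h _).trans (le_of_eq ?_)
    rw [hk2, ← mul_assoc, ← mul_assoc, ← ENNReal.ofReal_mul (by positivity),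
      ← ENNReal.ofReal_mul (by positivity), ← ENNReal.ofReal_pow (by positivity),
      Real.sq_sqrt (by positivity)]
    congr 2
    field_simp
    ring
  · refine eLpNorm_two_le_of_lintegral_sq_le ?_
    set k : ℝ × ℝ → ℂ := fun ξ => Complex.exp (Complex.I * (x * ξ.1 : ℝ)) * ft2 φ ξ
    have hk : Continuous k := by
      have := continuous_ft2 φ
      fun_prop
    have hk2 : ∫⁻ ξ, ‖k ξ‖ₑ ^ 2
        = ENNReal.ofReal ((2 * Real.pi) ^ 2) * ∫⁻ x, ‖φ x‖ₑ ^ 2 := by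
      simp only [k, enorm_exp_I_mul_ofReal_mul, lintegral_sq_ft2]
    have h := lintegral_sq_integral_mul_abs_rpow_le (m - 1) hk.measurable
      (hk2 ▸ ENNReal.mul_lt_top ENNReal.ofReal_lt_top φ.lintegral_sq_lt_top)
    simp only [evo2, lintegral_sq_smul]
    have e : ∀ p ξ : ℝ × ℝ,
        Complex.exp (Complex.I *
            ((x * ξ.1 + p.2 * ξ.2 + p.1 * (ξ.1 * |ξ.2| ^ (m - 1)) : ℝ) : ℂ)) *
          ((|ξ.2| ^ ((m - 1) / 2) : ℝ) : ℂ) * ft2 φ ξ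
        = Complex.exp (Complex.I * (p.1 * (ξ.1 * |ξ.2| ^ (m - 1)) + p.2 * ξ.2 : ℝ)) *
          (((|ξ.2| ^ ((m - 1) / 2) : ℝ) : ℂ) * k ξ) := fun p ξ => by
      rw [add_assoc, add_comm (p.2 * ξ.2), Complex.ofReal_add, mul_add, Complex.exp_add]
      ring
    simp only [e]
    refine (mul_le_mul_right h _).trans (le_of_eq ?_)
    rw [hk2, one_mul, ← mul_assoc, ← mul_assoc, ← ENNReal.ofReal_mul (by positivity),
      ← ENNReal.ofReal_mul (by positivity), ← ENNReal.ofReal_pow (by positivity)]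
    congr 2
    field_simp
  · refine eLpNorm_two_eq_of_lintegral_sq_eq ?_
    have hφ := lintegral_sq_ft1 φ
    have h := lintegral_sq_integral_exp_real (integrable_ft1 φ)
      (hφ ▸ ENNReal.mul_lt_top ENNReal.ofReal_lt_top φ.lintegral_sq_lt_top)
    rw [← lintegral_add_left_eq_self _ x, hφ] at h
    simp only [evo1, lintegral_sq_smul, mul_one, ← add_mul]
    rw [h, ← mul_assoc, ← mul_assoc, ← ENNReal.ofReal_mul (by positivity),
      ← ENNReal.ofReal_mul (by positivity)]
    have : ((2 * Real.pi)⁻¹) ^ 2 * (2 * Real.pi) * (2 * Real.pi) = 1 := by field_simp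
    rw [this, ENNReal.ofReal_one, one_mul]

end
end

section
/- Let n = 1 and l, m > 0, and let φ be a Schwartz function on ℝ whose Fourier transform is supported in [0,∞) or in (−∞,0]. Then for every x ∈ ℝ one has the exact equality ‖|D_x|^{(m-1)/2} e^{it|D_x|^m} φ(x)‖_{L²(ℝ_t)} = √(l/m) · ‖|D_x|^{(l-1)/2} e^{it|D_x|^l} φ(x)‖_{L²(ℝ_t)}. -/
open MeasureTheory
open scoped ENNReal

noncomputable section

open Set Filter FourierTransform SchwartzMap
open scoped ContDiff Topology

/-- Plancherel's theorem for the Fourier integral of a function in `L¹ ∩ L²`. -/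
theorem eLpNorm_fourier_eq_of_integrable_of_memLp {E F : Type*}
    [NormedAddCommGroup E] [MeasurableSpace E] [BorelSpace E]
    [InnerProductSpace ℝ E] [FiniteDimensional ℝ E]
    [NormedAddCommGroup F] [InnerProductSpace ℂ F] [CompleteSpace F]
    {g : E → F} (hg : Integrable g) (hg2 : MemLp g 2) :
    eLpNorm (𝓕 g) 2 volume = eLpNorm g 2 volume := by
  have hcont : Continuous (𝓕 g) :=
    VectorFourier.fourierIntegral_continuous Real.continuous_fourierChar
      continuous_inner hg
  have hae : 𝓕 g =ᵐ[volume] (𝓕 (hg2.toLp g) : Lp F 2 (volume : Measure E)) := by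
    refine ae_eq_of_integral_contDiff_smul_eq (hcont.locallyIntegrable)
      ((Lp.memLp _).locallyIntegrable (by norm_num)) fun φ hφ hφc => ?_
    have h1 : HasCompactSupport (Complex.ofRealCLM ∘ φ) := hφc.comp_left rfl
    have h2 : ContDiff ℝ ∞ (Complex.ofRealCLM ∘ φ) := by fun_prop
    let Φ : 𝓢(E, ℂ) := h1.toSchwartzMap h2
    have key := congrArg (fun T => T Φ) (Lp.fourier_toTemperedDistribution_eq (hg2.toLp g))
    simp only [TemperedDistribution.fourier_apply, Lp.toTemperedDistribution_apply] at key
    have hflip : ∫ ξ, (𝓕 (Φ : E → ℂ) ξ) • g ξ = ∫ x, Φ x • 𝓕 g x := by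
      have := VectorFourier.integral_fourierIntegral_smul_eq_flip (μ := (volume : Measure E))
        (ν := (volume : Measure E)) (L := innerₗ E) Real.continuous_fourierChar
        continuous_inner Φ.integrable hg
      rwa [flip_innerₗ] at this
    calc ∫ x, φ x • 𝓕 g x = ∫ x, Φ x • 𝓕 g x := by
          refine integral_congr_ae (.of_forall fun x => ?_)
          simp [Φ]
      _ = ∫ ξ, (𝓕 Φ) ξ • (hg2.toLp g) ξ := by
          rw [← hflip, ← SchwartzMap.fourier_coe]
          refine integral_congr_ae ?_
          filter_upwards [hg2.coeFn_toLp] with x hx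
          rw [hx]
      _ = _ := by
          rw [key]
          refine integral_congr_ae (.of_forall fun x => ?_)
          simp [Φ]
  rw [eLpNorm_congr_ae hae, ← eLpNorm_congr_ae hg2.coeFn_toLp,
    ← ENNReal.toReal_eq_toReal_iff' (Lp.eLpNorm_ne_top _) (Lp.eLpNorm_ne_top _)]
  exact Lp.norm_fourier_eq (hg2.toLp g)

theorem lintegral_comp_rpow_Ioi (f : ℝ → ℝ≥0∞) {p : ℝ} (hp : 0 < p) :
    ∫⁻ s in Ioi (0 : ℝ), f s =
      ∫⁻ ξ in Ioi (0 : ℝ), ENNReal.ofReal (p * ξ ^ (p - 1)) * f (ξ ^ p) := by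
  have himage : (· ^ p) '' (Ioi 0) = Ioi (0 : ℝ) := by
    ext y
    refine ⟨?_, fun hy => ⟨y ^ p⁻¹, Real.rpow_pos_of_pos hy _, ?_⟩⟩
    · rintro ⟨ξ, hξ, rfl⟩
      exact Real.rpow_pos_of_pos hξ p
    · exact Real.rpow_inv_rpow (le_of_lt hy) hp.ne'
  have h := lintegral_image_eq_lintegral_abs_deriv_mul measurableSet_Ioi
    (fun x hx => (Real.hasDerivAt_rpow_const (p := p)
      (Or.inl (mem_Ioi.mp hx).ne')).hasDerivWithinAt)
    ((Real.rpow_left_injOn hp.ne').mono fun x (hx : 0 < x) => hx.le) f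
  rw [himage] at h
  rw [h]
  refine setLIntegral_congr_fun measurableSet_Ioi fun ξ hξ => ?_
  have : 0 ≤ p * ξ ^ (p - 1) := mul_nonneg hp.le (Real.rpow_nonneg (le_of_lt hξ) _)
  simp only [abs_of_nonneg this]

theorem eLpNorm_comp_mul_left {F : Type*} [NormedAddCommGroup F] (f : ℝ → F) {c : ℝ}
    (hc : c ≠ 0) :
    eLpNorm (fun t => f (c * t)) 2 volume =
      ENNReal.ofReal (Real.sqrt |c⁻¹|) * eLpNorm f 2 volume := by
  have h := (measurableEmbedding_mulLeft₀ hc).eLpNorm_map_measure (g := f) (p := 2)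
    (μ := volume)
  rw [Real.map_volume_mul_left hc, eLpNorm_smul_measure_of_ne_top (by norm_num)] at h
  rw [show (fun t => f (c * t)) = f ∘ (c * ·) from rfl, ← h, Real.sqrt_eq_rpow,
    ← ENNReal.ofReal_rpow_of_nonneg (abs_nonneg _) (by norm_num)]
  simp

/-- The time `L²` norm of an oscillatory integral with phase `t ξ ^ p` on the half line. -/
theorem eLpNorm_integral_cexp_rpow_Ioi {p : ℝ} (hp : 0 < p) {h : ℝ → ℂ}
    (hint : IntegrableOn (fun ξ => ((ξ ^ ((p - 1) / 2) : ℝ) : ℂ) * h ξ) (Ioi 0))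
    (hL2 : eLpNorm h 2 (volume.restrict (Ioi 0)) ≠ ⊤) :
    eLpNorm (fun t : ℝ => ∫ ξ in Ioi (0 : ℝ), Complex.exp (Complex.I * ((t * ξ ^ p : ℝ) : ℂ)) *
        (((ξ ^ ((p - 1) / 2) : ℝ) : ℂ) * h ξ)) 2 volume =
      ENNReal.ofReal (Real.sqrt (2 * Real.pi / p)) *
        eLpNorm h 2 (volume.restrict (Ioi 0)) := by
  set g : ℝ → ℂ := fun s => ((p⁻¹ * (s ^ p⁻¹) ^ ((1 - p) / 2) : ℝ) : ℂ) * h (s ^ p⁻¹)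
  have hroot : ∀ ξ ∈ Ioi (0 : ℝ), (ξ ^ p) ^ p⁻¹ = ξ := fun ξ hξ =>
    Real.rpow_rpow_inv (le_of_lt hξ) hp.ne'
  have hsubst : ∀ ξ ∈ Ioi (0 : ℝ), (p * ξ ^ (p - 1)) • g (ξ ^ p) =
      ((ξ ^ ((p - 1) / 2) : ℝ) : ℂ) * h ξ := by
    intro ξ hξ
    simp only [g, hroot ξ hξ, Complex.real_smul, ← mul_assoc, ← Complex.ofReal_mul]
    congr 2
    rw [show (p - 1) / 2 = (p - 1) + (1 - p) / 2 by ring, Real.rpow_add hξ]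
    field_simp
  have hgint : IntegrableOn g (Ioi 0) := by
    rw [← integrableOn_Ioi_comp_rpow_iff g hp.ne', abs_of_pos hp]
    exact hint.congr_fun (fun ξ hξ => (hsubst ξ hξ).symm) measurableSet_Ioi
  have hgnorm : eLpNorm g 2 (volume.restrict (Ioi 0)) =
      ENNReal.ofReal (Real.sqrt p⁻¹) * eLpNorm h 2 (volume.restrict (Ioi 0)) := by
    have hsq : ∫⁻ s in Ioi (0 : ℝ), ‖g s‖ₑ ^ (2 : ℝ) =
        ENNReal.ofReal p⁻¹ * ∫⁻ ξ in Ioi (0 : ℝ), ‖h ξ‖ₑ ^ (2 : ℝ) := by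
      rw [lintegral_comp_rpow_Ioi _ hp, ← lintegral_const_mul' _ _ ENNReal.ofReal_ne_top]
      refine setLIntegral_congr_fun measurableSet_Ioi fun ξ hξ => ?_
      have hξ' : (0 : ℝ) < ξ := hξ
      simp only [g, hroot ξ hξ, enorm_mul]
      rw [ENNReal.mul_rpow_of_nonneg _ _ (by norm_num), ← mul_assoc]
      congr 1
      rw [← ofReal_norm, Complex.norm_real, Real.norm_of_nonneg (by positivity),
        ENNReal.ofReal_rpow_of_nonneg (by positivity) (by norm_num),
        ← ENNReal.ofReal_mul (by positivity)]
      congr 1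
      rw [Real.mul_rpow (by positivity) (by positivity), ← Real.rpow_mul hξ'.le,
        show (1 - p) / 2 * 2 = -(p - 1) by ring, Real.rpow_neg hξ'.le]
      have : ξ ^ (p - 1) ≠ 0 := by positivity
      norm_num
      field_simp
    rw [eLpNorm_eq_lintegral_rpow_enorm_toReal (by norm_num) (by norm_num),
      eLpNorm_eq_lintegral_rpow_enorm_toReal (by norm_num) (by norm_num)]
    simp only [ENNReal.toReal_ofNat]
    rw [hsq, ENNReal.mul_rpow_of_nonneg _ _ (by norm_num), Real.sqrt_eq_rpow,
      ENNReal.ofReal_rpow_of_nonneg (by positivity) (by norm_num)]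
  have hG1 : Integrable ((Ioi (0 : ℝ)).indicator g) :=
    (integrable_indicator_iff measurableSet_Ioi).2 hgint
  have hGnorm : eLpNorm ((Ioi (0 : ℝ)).indicator g) 2 volume =
      ENNReal.ofReal (Real.sqrt p⁻¹) * eLpNorm h 2 (volume.restrict (Ioi 0)) := by
    rw [eLpNorm_indicator_eq_eLpNorm_restrict measurableSet_Ioi, hgnorm]
  have hG2 : MemLp ((Ioi (0 : ℝ)).indicator g) 2 :=
    ⟨hG1.aestronglyMeasurable, by
      rw [hGnorm]; exact ENNReal.mul_lt_top ENNReal.ofReal_lt_top hL2.lt_top⟩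
  have hfun : (fun t : ℝ => ∫ ξ in Ioi (0 : ℝ),
      Complex.exp (Complex.I * ((t * ξ ^ p : ℝ) : ℂ)) * (((ξ ^ ((p - 1) / 2) : ℝ) : ℂ) * h ξ)) =
      fun t => 𝓕 ((Ioi (0 : ℝ)).indicator g) (-(2 * Real.pi)⁻¹ * t) := by
    funext t
    rw [Real.fourier_real_eq_integral_exp_smul]
    have : ∀ s : ℝ, Complex.exp (((-2 * Real.pi * s * (-(2 * Real.pi)⁻¹ * t) : ℝ) : ℂ) *
        Complex.I) • (Ioi (0 : ℝ)).indicator g s =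
        (Ioi (0 : ℝ)).indicator
          (fun s => Complex.exp (Complex.I * ((t * s : ℝ) : ℂ)) * g s) s := by
      intro s
      rw [show -2 * Real.pi * s * (-(2 * Real.pi)⁻¹ * t) = t * s by
        have := Real.pi_ne_zero; field_simp]
      by_cases hs : s ∈ Ioi (0 : ℝ)
      · simp only [indicator_of_mem hs, smul_eq_mul, mul_comm Complex.I]
      · simp only [indicator_of_notMem hs, smul_zero]
    simp_rw [this]
    rw [integral_indicator measurableSet_Ioi, ← integral_comp_rpow_Ioi_of_pos
      (g := fun s => Complex.exp (Complex.I * ((t * s : ℝ) : ℂ)) * g s) hp]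
    refine setIntegral_congr_fun measurableSet_Ioi fun ξ hξ => ?_
    simp only [← mul_smul_comm, hsubst ξ hξ]
  rw [hfun, eLpNorm_comp_mul_left _ (neg_ne_zero.2 (by positivity)),
    eLpNorm_fourier_eq_of_integrable_of_memLp hG1 hG2, hGnorm, ← mul_assoc,
    ← ENNReal.ofReal_mul (by positivity), ← Real.sqrt_mul (by positivity)]
  congr 3
  rw [inv_neg, abs_neg, inv_inv, abs_of_pos (by positivity), div_eq_mul_inv]

theorem ft1_eq_fourier (φ : ℝ → ℂ) (ξ : ℝ) : ft1 φ ξ = 𝓕 φ ((2 * Real.pi)⁻¹ * ξ) := by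
  rw [Real.fourier_real_eq_integral_exp_smul, ft1]
  refine integral_congr_ae (.of_forall fun x => ?_)
  have : -2 * Real.pi * x * ((2 * Real.pi)⁻¹ * ξ) = -(x * ξ) := by
    have := Real.pi_ne_zero; field_simp
  simp only [this, smul_eq_mul]
  push_cast
  ring_nf

/-- Rescalings of the Fourier transform of a Schwartz function are Schwartz. -/
theorem exists_schwartzMap_eq_ft1 (φ : 𝓢(ℝ, ℂ)) {c : ℝ} (hc : c ≠ 0) :
    ∃ ψ : 𝓢(ℝ, ℂ), ∀ ξ, ψ ξ = ft1 φ (c * ξ) := by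
  have hc' : (2 * Real.pi)⁻¹ * c ≠ 0 := mul_ne_zero (by positivity) hc
  refine ⟨SchwartzMap.compCLMOfContinuousLinearEquiv ℝ
    (ContinuousLinearEquiv.unitsEquivAut ℝ (Units.mk0 _ hc')) (𝓕 φ), fun ξ => ?_⟩
  rw [ft1_eq_fourier, SchwartzMap.compCLMOfContinuousLinearEquiv_apply, SchwartzMap.fourier_coe]
  simp only [Function.comp_apply, ContinuousLinearEquiv.unitsEquivAut_apply, Units.val_mk0]
  rw [mul_comm ξ, mul_assoc]

theorem SchwartzMap.integrableOn_rpow_mul_Ioi (ψ : 𝓢(ℝ, ℂ)) {a : ℝ} (ha : -1 < a) :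
    IntegrableOn (fun ξ => ξ ^ a * ‖ψ ξ‖) (Ioi 0) := by
  have htop : (fun ξ => ‖ψ ξ‖) =O[atTop] fun ξ : ℝ => ξ ^ (-(a + 2)) := by
    have h := ((ψ.isBigO_cocompact_rpow (-(a + 2))).mono atTop_le_cocompact).norm_left
    refine h.congr' EventuallyEq.rfl ?_
    filter_upwards [eventually_ge_atTop 0] with ξ hξ
    rw [Real.norm_of_nonneg hξ]
  have hbot : (fun ξ => ‖ψ ξ‖) =O[𝓝[>] 0] fun ξ : ℝ => ξ ^ (-(0 : ℝ)) := by
    simp only [neg_zero, Real.rpow_zero]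
    exact ((ψ.continuous.norm.tendsto 0).mono_left nhdsWithin_le_nhds).isBigO_one ℝ
  have := mellin_convergent_of_isBigO_scalar (s := a + 1)
    (ψ.continuous.norm.locallyIntegrable.locallyIntegrableOn _) htop (by linarith) hbot
    (by linarith)
  simpa using this

/-- If `ft1 φ` lives on the half line `c ξ ≥ 0`, `c = ±1`, the time `L²` norm of the evolution
with symbol `|ξ| ^ p` depends on `p` only through an explicit constant. -/
theorem eLpNorm_evo1_rpow {p : ℝ} (hp : 0 < p) (φ : 𝓢(ℝ, ℂ)) {c : ℝ} (hc : c = 1 ∨ c = -1)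
    (hsupp : ∀ ξ < 0, ft1 φ (c * ξ) = 0) (x : ℝ) :
    eLpNorm (fun t : ℝ =>
        evo1 (fun ξ => |ξ| ^ p) (fun ξ => ((|ξ| ^ ((p - 1) / 2) : ℝ) : ℂ)) φ t x) 2 volume =
      ENNReal.ofReal (Real.sqrt p⁻¹) *
        (ENNReal.ofReal ((2 * Real.pi)⁻¹ * Real.sqrt (2 * Real.pi)) *
          eLpNorm (fun ξ => ft1 φ (c * ξ)) 2 (volume.restrict (Ioi 0))) := by
  have hcabs : |c| = 1 := by rcases hc with rfl | rfl <;> simp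
  obtain ⟨ψ, hψ⟩ := exists_schwartzMap_eq_ft1 φ (c := c) (by rintro rfl; simp at hcabs)
  set h : ℝ → ℂ := fun ξ => Complex.exp (Complex.I * ((x * (c * ξ) : ℝ) : ℂ)) * ψ ξ
  have hexp : ∀ y : ℝ, ‖Complex.exp (Complex.I * (y : ℂ))‖ = 1 := fun y => by
    rw [mul_comm]; exact Complex.norm_exp_ofReal_mul_I y
  have hnorm : ∀ ξ, ‖h ξ‖ = ‖ψ ξ‖ := fun ξ => by
    simp only [h, norm_mul, hexp, one_mul]
  have hhcont : Continuous h := by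
    have := ψ.continuous
    fun_prop
  have heL : eLpNorm h 2 (volume.restrict (Ioi 0)) =
      eLpNorm (fun ξ => ft1 φ (c * ξ)) 2 (volume.restrict (Ioi 0)) := by
    refine eLpNorm_congr_norm_ae (.of_forall fun ξ => ?_)
    rw [hnorm, hψ]
  have hfin : eLpNorm h 2 (volume.restrict (Ioi 0)) ≠ ⊤ := by
    have heψ : eLpNorm h 2 (volume.restrict (Ioi 0)) = eLpNorm ψ 2 (volume.restrict (Ioi 0)) :=
      eLpNorm_congr_norm_ae (.of_forall hnorm)
    rw [heψ]
    have hψ2 : MemLp ψ 2 volume := ψ.memLp 2 volume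
    exact (hψ2.restrict (Ioi 0)).eLpNorm_ne_top
  have hint : IntegrableOn (fun ξ => ((ξ ^ ((p - 1) / 2) : ℝ) : ℂ) * h ξ) (Ioi 0) := by
    refine (ψ.integrableOn_rpow_mul_Ioi (a := (p - 1) / 2) (by linarith)).mono' ?_ ?_
    · exact (by fun_prop : Measurable fun ξ : ℝ => ((ξ ^ ((p - 1) / 2) : ℝ) : ℂ))
        |>.aestronglyMeasurable.mul hhcont.aestronglyMeasurable
    · refine (ae_restrict_iff' measurableSet_Ioi).2 (.of_forall fun ξ hξ => ?_)
      rw [norm_mul, hnorm, Complex.norm_real,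
        Real.norm_of_nonneg (Real.rpow_nonneg (le_of_lt hξ) _)]
  have hevo : (fun t : ℝ =>
      evo1 (fun ξ => |ξ| ^ p) (fun ξ => ((|ξ| ^ ((p - 1) / 2) : ℝ) : ℂ)) φ t x) =
      (2 * Real.pi : ℝ)⁻¹ • fun t : ℝ => ∫ ξ in Ioi (0 : ℝ),
        Complex.exp (Complex.I * ((t * ξ ^ p : ℝ) : ℂ)) *
          (((ξ ^ ((p - 1) / 2) : ℝ) : ℂ) * h ξ) := by
    funext t
    simp only [evo1, Pi.smul_apply]
    congr 1
    set f : ℝ → ℂ := fun ξ => Complex.exp (Complex.I * ((x * ξ + t * |ξ| ^ p : ℝ) : ℂ)) *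
      ((|ξ| ^ ((p - 1) / 2) : ℝ) : ℂ) * ft1 φ ξ
    have hrefl : ∫ ξ, f ξ = ∫ ξ, f (c * ξ) := by
      rcases hc with rfl | rfl
      · simp
      · simpa using (integral_neg_eq_self f volume).symm
    rw [hrefl, ← setIntegral_eq_integral_of_forall_compl_eq_zero (s := Ici 0),
      integral_Ici_eq_integral_Ioi]
    · refine setIntegral_congr_fun measurableSet_Ioi fun ξ hξ => ?_
      simp only [f, h, abs_mul, hcabs, one_mul, abs_of_pos (mem_Ioi.1 hξ), hψ,
        Complex.ofReal_add, mul_add, Complex.exp_add]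
      ring
    · intro ξ hξ
      simp only [f, hsupp ξ (by simpa using hξ), mul_zero]
  rw [hevo, eLpNorm_const_smul, eLpNorm_integral_cexp_rpow_Ioi hp hint hfin, heL, ← mul_assoc,
    ← mul_assoc, ← ofReal_norm, Real.norm_of_nonneg (by positivity),
    ← ENNReal.ofReal_mul (by positivity), ← ENNReal.ofReal_mul (by positivity),
    div_eq_mul_inv, Real.sqrt_mul (by positivity)]
  congr 2
  ring

/-- For `l, m > 0` and `φ` with `φ̂` supported in `[0,∞)` or in `(-∞,0]`, for every `x`:
`‖|D_x|^{(m-1)/2} e^{it|D_x|^m} φ(x)‖_{L²(ℝ_t)}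
  = √(l/m) ‖|D_x|^{(l-1)/2} e^{it|D_x|^l} φ(x)‖_{L²(ℝ_t)}`. -/
theorem one_dimensional_exact_comparison
    (l m : ℝ) (hl : 0 < l) (hm : 0 < m)
    (φ : SchwartzMap ℝ ℂ)
    (hsupp : Function.support (ft1 (⇑φ)) ⊆ Set.Ici (0 : ℝ) ∨
      Function.support (ft1 (⇑φ)) ⊆ Set.Iic (0 : ℝ)) :
    ∀ x : ℝ,
      eLpNorm (fun t : ℝ =>
          evo1 (fun ξ => |ξ| ^ m) (fun ξ => ((|ξ| ^ ((m - 1) / 2) : ℝ) : ℂ)) (⇑φ) t x)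
          2 volume
        = ENNReal.ofReal (Real.sqrt (l / m)) *
          eLpNorm (fun t : ℝ =>
            evo1 (fun ξ => |ξ| ^ l) (fun ξ => ((|ξ| ^ ((l - 1) / 2) : ℝ) : ℂ)) (⇑φ) t x)
            2 volume := by
  intro x
  obtain ⟨c, hc, hcsupp⟩ : ∃ c : ℝ, (c = 1 ∨ c = -1) ∧ ∀ ξ < 0, ft1 φ (c * ξ) = 0 := by
    rcases hsupp with h | h
    · refine ⟨1, .inl rfl, fun ξ hξ => by_contra fun hne => ?_⟩
      have : (0 : ℝ) ≤ 1 * ξ := h hne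
      linarith
    · refine ⟨-1, .inr rfl, fun ξ hξ => by_contra fun hne => ?_⟩
      have : -1 * ξ ≤ (0 : ℝ) := h hne
      linarith
  rw [eLpNorm_evo1_rpow hm φ hc hcsupp x, eLpNorm_evo1_rpow hl φ hc hcsupp x,
    ← mul_assoc _ _ (_ * _), ← ENNReal.ofReal_mul (by positivity), ← Real.sqrt_mul (by positivity)]
  congr 3
  field_simp

end
end
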